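/- Let A, B, C be multiplicative characters on F_q. Then ₂F₁*(A, B; C | 1) = g(AC̄)g(BC̄)/(g(C̄)g(ABC̄)) + [q(q-1)·(AB)(-1)/(g(A)g(B)g(C̄))]·δ(ABC̄), where δ of a multiplicative character equals 1 if the character is trivial and 0 otherwise. -/

import Mathlib

/-- Multiplicative characters of a finite field with values in `ℂ` form a finite type. -/
noncomputable instance mulCharFintypeC (F : Type*) [Field F] [Fintype F] :
    Fintype (MulChar F ℂ) :=
  Fintype.ofFinite _

/-- The canonical additive character `θ(α) = ζ^{tr(α)}` of a finite field `F` of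
characteristic `p`, where `ζ` is a fixed primitive `p`-th root of unity in `ℂ`
and `tr` is the trace map to `ZMod p = F_p`. -/
noncomputable def addCharTheta (p : ℕ) (F : Type*) [Field F] [Fintype F]
    [Algebra (ZMod p) F] (zeta : ℂ) (a : F) : ℂ :=
  zeta ^ (Algebra.trace (ZMod p) F a).val

/-- The Gauss sum `g(χ) = ∑_{x ∈ F} χ(x) θ(x)`. -/
noncomputable def gaussS (p : ℕ) (F : Type*) [Field F] [Fintype F]
    [Algebra (ZMod p) F] (zeta : ℂ) (χ : MulChar F ℂ) : ℂ :=
  ∑ x : F, χ x * addCharTheta p F zeta x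

/-- McCarthy's finite field hypergeometric function
`₂F₁*(A₀, A₁; B₁ | x) = (1/(q-1)) ∑_χ [g(A₀χ)g(A₁χ)g((B₁χ)⁻¹)g(χ⁻¹)/(g(A₀)g(A₁)g(B₁⁻¹))] χ(x)`. -/
noncomputable def mcCarthy2F1 (p : ℕ) (F : Type*) [Field F] [Fintype F]
    [Algebra (ZMod p) F] (zeta : ℂ) (A₀ A₁ B₁ : MulChar F ℂ) (x : F) : ℂ :=
  (1 / ((Fintype.card F : ℂ) - 1)) * ∑ χ : MulChar F ℂ,
    gaussS p F zeta (A₀ * χ) * gaussS p F zeta (A₁ * χ) * gaussS p F zeta (B₁ * χ)⁻¹ *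
      gaussS p F zeta χ⁻¹ /
        (gaussS p F zeta A₀ * gaussS p F zeta A₁ * gaussS p F zeta B₁⁻¹) * χ x

/-- The finite field Appell function `F₄*(A; B; C, C'; x, y)`. -/
noncomputable def appellF4star (p : ℕ) (F : Type*) [Field F] [Fintype F]
    [Algebra (ZMod p) F] (zeta : ℂ) (A B C C' : MulChar F ℂ) (x y : F) : ℂ :=
  (1 / ((Fintype.card F : ℂ) - 1) ^ 2) * ∑ ψ : MulChar F ℂ, ∑ χ : MulChar F ℂ,
    gaussS p F zeta (A * χ * ψ) * gaussS p F zeta (B * χ * ψ) * gaussS p F zeta (C * ψ)⁻¹ *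
      gaussS p F zeta (C' * χ)⁻¹ * gaussS p F zeta ψ⁻¹ * gaussS p F zeta χ⁻¹ /
        (gaussS p F zeta A * gaussS p F zeta B * gaussS p F zeta C⁻¹ *
          gaussS p F zeta C'⁻¹) *
      (ψ x * χ y)

/-- The finite field Appell function `F₁*(A; B, B'; C; x, y)`. -/
noncomputable def appellF1star (p : ℕ) (F : Type*) [Field F] [Fintype F]
    [Algebra (ZMod p) F] (zeta : ℂ) (A B B' C : MulChar F ℂ) (x y : F) : ℂ :=
  (1 / ((Fintype.card F : ℂ) - 1) ^ 2) * ∑ ψ : MulChar F ℂ, ∑ χ : MulChar F ℂ,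
    gaussS p F zeta (A * χ * ψ) * gaussS p F zeta (B * ψ) * gaussS p F zeta (B' * χ) *
      gaussS p F zeta (C * χ * ψ)⁻¹ * gaussS p F zeta ψ⁻¹ * gaussS p F zeta χ⁻¹ /
        (gaussS p F zeta A * gaussS p F zeta B * gaussS p F zeta B' *
          gaussS p F zeta C⁻¹) *
      (ψ x * χ y)

/-- The Jacobi sum `J(A,B) = ∑_{x ∈ F} A(x) B(1-x)`. -/
noncomputable def jacobiS (F : Type*) [Field F] [Fintype F] (A B : MulChar F ℂ) : ℂ :=
  ∑ x : F, A x * B (1 - x)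

/-- Greene's binomial coefficient `(A choose B) = (B(-1)/q) J(A, B⁻¹)`. -/
noncomputable def binomChar (F : Type*) [Field F] [Fintype F] (A B : MulChar F ℂ) : ℂ :=
  (B (-1) / (Fintype.card F : ℂ)) * jacobiS F A B⁻¹

section CharacterSums

variable {F : Type*} [Field F] [Fintype F]

namespace MulChar

lemma sum_mul_eq_sum_units [DecidableEq F] {R : Type*} [CommRing R] (χ : MulChar F R) (f : F → R) :
    ∑ x : F, χ x * f x = ∑ u : Fˣ, χ u * f u := by
  refine (Finset.sum_of_injOn (fun u : Fˣ => (u : F)) (fun a _ b _ h => Units.ext h)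
    (fun _ _ => Finset.mem_coe.2 (Finset.mem_univ _)) (fun x _ hx => ?_) fun _ _ => rfl).symm
  rw [χ.map_nonunit, zero_mul]
  rintro ⟨u, rfl⟩
  exact hx ⟨u, by simp, rfl⟩

lemma sum_eq_sum_units [DecidableEq F] {R : Type*} [CommRing R] (χ : MulChar F R) :
    ∑ x : F, χ x = ∑ u : Fˣ, χ u := by
  simpa using sum_mul_eq_sum_units χ fun _ => 1

/-- Orthogonality of the complex multiplicative characters of a finite field. -/
lemma sum_apply_unit [DecidableEq F] (v : Fˣ) :
    ∑ χ : MulChar F ℂ, χ v = if v = 1 then (Fintype.card F : ℂ) - 1 else 0 := by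
  have : NeZero (Monoid.exponent Fˣ : ℂ) :=
    ⟨Nat.cast_ne_zero.2 Monoid.exponent_ne_zero_of_finite⟩
  split_ifs with hv
  · have h := card_eq_card_units_of_hasEnoughRootsOfUnity F ℂ
    rw [Nat.card_eq_fintype_card, Nat.card_eq_fintype_card, Fintype.card_units] at h
    simp only [hv, Units.val_one, map_one, Finset.sum_const, Finset.card_univ, nsmul_eq_mul,
      mul_one]
    rw [h, Nat.cast_sub Fintype.card_pos, Nat.cast_one]
  · obtain ⟨χ, hχ⟩ := exists_apply_ne_one_of_hasEnoughRootsOfUnity F ℂ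
      (a := (v : F)) (by simpa using hv)
    refine eq_zero_of_mul_eq_self_left hχ ?_
    simp only [Finset.mul_sum, ← MulChar.mul_apply]
    exact Fintype.sum_bijective _ (Group.mulLeft_bijective χ) _ _ fun _ => rfl

end MulChar

lemma gaussSum_eq_sum_units [DecidableEq F] (χ : MulChar F ℂ) (ψ : AddChar F ℂ) (a : Fˣ) :
    gaussSum χ ψ = ∑ u : Fˣ, χ (a * u) * ψ (a * u) := by
  rw [gaussSum, MulChar.sum_mul_eq_sum_units]
  exact (Fintype.sum_equiv (Equiv.mulLeft a) _ _ fun u => by simp).symm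

lemma gaussSum_mulShift_of_ne_one {χ : MulChar F ℂ} (hχ : χ ≠ 1) (ψ : AddChar F ℂ) (c : F) :
    gaussSum χ (ψ.mulShift c) = χ⁻¹ c * gaussSum χ ψ := by
  rcases eq_or_ne c 0 with rfl | hc
  · simp [gaussSum, MulChar.sum_eq_zero_of_ne_one hχ, MulChar.map_zero]
  · exact gaussSum_mulShift_eq χ ψ (Units.mk0 c hc)

lemma gaussSum_mul_gaussSum_inv (χ : MulChar F ℂ) {ψ : AddChar F ℂ} (hψ : ψ.IsPrimitive) :
    gaussSum χ ψ * gaussSum χ⁻¹ ψ = Fintype.card F * χ (-1) - ∑ x : F, χ x := by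
  classical
  rcases eq_or_ne χ 1 with rfl | hχ
  · have hψ1 : ψ ≠ 1 := by simpa using hψ one_ne_zero
    have h1 : (1 : MulChar F ℂ) (-1) = 1 := MulChar.one_apply isUnit_one.neg
    rw [inv_one, gaussSum_one_left hψ1, MulChar.sum_one_eq_card_units, Fintype.card_units,
      Nat.cast_sub Fintype.card_pos, h1]
    push_cast
    ring
  · have h := mul_gaussSum_inv_eq_gaussSum χ⁻¹ ψ
    have h2 : χ⁻¹ (-1) = χ (-1) := by rw [MulChar.inv_apply', inv_neg_one]
    rw [MulChar.sum_eq_zero_of_ne_one hχ, sub_zero, ← h, ← gaussSum_mul_gaussSum_eq_card hχ hψ, h2]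
    ring

lemma gaussSum_ne_zero (χ : MulChar F ℂ) {ψ : AddChar F ℂ} (hψ : ψ.IsPrimitive) :
    gaussSum χ ψ ≠ 0 := by
  rcases eq_or_ne χ 1 with rfl | hχ
  · rw [gaussSum_one_left (by simpa using hψ one_ne_zero)]
    simp
  · exact gaussSum_ne_zero_of_nontrivial (by simp) hχ hψ

/-- The sum over characters of a product of four Gauss sums is a sum over the singular matrices
with nonzero entries, parametrized as `s`, `s * t`, `s * u`, `s * t * u`. -/
lemma sum_gaussSum_mul_eq_sum_units [DecidableEq F] (A B C : MulChar F ℂ)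
    (ψ : AddChar F ℂ) :
    ∑ χ : MulChar F ℂ,
        gaussSum (A * χ) ψ * gaussSum (B * χ) ψ * gaussSum (C * χ⁻¹) ψ * gaussSum χ⁻¹ ψ =
      ((Fintype.card F : ℂ) - 1) * ∑ t : Fˣ, ∑ u : Fˣ,
        (B * C) t * B u * gaussSum (A * B * C) (ψ.mulShift ((1 + t) * (1 + u))) := by
  have key (χ : MulChar F ℂ) :
      gaussSum (A * χ) ψ * gaussSum (B * χ) ψ * gaussSum (C * χ⁻¹) ψ * gaussSum χ⁻¹ ψ =
        ∑ s : Fˣ, ∑ t : Fˣ, ∑ u : Fˣ, ∑ v : Fˣ,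
          (A s * C (s * t) * B (s * t * u * v) *
            ψ (s + s * t + s * u + s * t * u * v)) * χ v := by
    rw [show gaussSum (A * χ) ψ * gaussSum (B * χ) ψ * gaussSum (C * χ⁻¹) ψ * gaussSum χ⁻¹ ψ =
      gaussSum (A * χ) ψ *
        (gaussSum (C * χ⁻¹) ψ * (gaussSum χ⁻¹ ψ * gaussSum (B * χ) ψ)) by ring,
      gaussSum_eq_sum_units (A * χ) ψ 1, Finset.sum_mul]
    refine Finset.sum_congr rfl fun s _ => ?_
    rw [gaussSum_eq_sum_units (C * χ⁻¹) ψ s, Finset.sum_mul, Finset.mul_sum]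
    refine Finset.sum_congr rfl fun t _ => ?_
    rw [gaussSum_eq_sum_units χ⁻¹ ψ s, Finset.sum_mul, Finset.mul_sum, Finset.mul_sum]
    refine Finset.sum_congr rfl fun u _ => ?_
    rw [gaussSum_eq_sum_units (B * χ) ψ (s * t * u), Finset.mul_sum, Finset.mul_sum,
      Finset.mul_sum]
    refine Finset.sum_congr rfl fun v _ => ?_
    have hχ (a : Fˣ) : χ a * χ⁻¹ a = 1 := by
      rw [← MulChar.mul_apply, mul_inv_cancel, MulChar.one_apply a.isUnit]
    simp only [MulChar.mul_apply, Units.val_mul, Units.val_one, one_mul, map_mul,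
      AddChar.map_add_eq_mul]
    linear_combination (A s * C s * C t * B s * B t * B u * B v * ψ s * ψ (s * t) * ψ (s * u) *
      ψ (s * t * u * v) * χ v) * ((χ s * χ⁻¹ s) ^ 2 * (χ t * χ⁻¹ t) * hχ u +
        (χ s * χ⁻¹ s) ^ 2 * hχ t + (χ s * χ⁻¹ s + 1) * hχ s)
  simp_rw [key]
  rw [Finset.sum_comm, Finset.mul_sum]
  have inner (s t u : Fˣ) : ∑ χ : MulChar F ℂ, ∑ v : Fˣ,
      (A s * C (s * t) * B (s * t * u * v) * ψ (s + s * t + s * u + s * t * u * v)) * χ v =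
      ((Fintype.card F : ℂ) - 1) * ((B * C) t * B u *
        ((A * B * C) s * ψ ((1 + t) * (1 + u) * s))) := by
    rw [Finset.sum_comm]
    simp_rw [← Finset.mul_sum, MulChar.sum_apply_unit]
    simp only [mul_ite, mul_zero, Finset.sum_ite_eq', Finset.mem_univ, if_true, Units.val_one,
      mul_one, MulChar.mul_apply, map_mul, map_one]
    rw [show (s : F) + s * t + s * u + s * t * u = (1 + t) * (1 + u) * s by ring]
    ring
  have step (s : Fˣ) : ∑ χ : MulChar F ℂ, ∑ t : Fˣ, ∑ u : Fˣ, ∑ v : Fˣ,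
      (A s * C (s * t) * B (s * t * u * v) * ψ (s + s * t + s * u + s * t * u * v)) * χ v =
      ∑ t : Fˣ, ∑ u : Fˣ, ((Fintype.card F : ℂ) - 1) * ((B * C) t * B u *
        ((A * B * C) s * ψ ((1 + t) * (1 + u) * s))) := by
    rw [Finset.sum_comm]
    refine Finset.sum_congr rfl fun t _ => ?_
    rw [Finset.sum_comm]
    exact Finset.sum_congr rfl fun u _ => inner s t u
  simp_rw [step]
  rw [Finset.sum_comm]
  refine Finset.sum_congr rfl fun t _ => ?_
  rw [Finset.sum_comm, Finset.mul_sum]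
  refine Finset.sum_congr rfl fun u _ => ?_
  rw [gaussSum, MulChar.sum_mul_eq_sum_units]
  simp_rw [AddChar.mulShift_apply, Finset.mul_sum]

lemma gaussSum_mul_sum_units_inv_one_add [DecidableEq F] {E : MulChar F ℂ} (hE : E ≠ 1)
    (B : MulChar F ℂ) (ψ : AddChar F ℂ) :
    gaussSum E ψ * ∑ u : Fˣ, B u * E⁻¹ (1 + u) = gaussSum B ψ * gaussSum (E * B⁻¹) ψ := by
  have h (u : Fˣ) : gaussSum E ψ * (B u * E⁻¹ (1 + u)) =
      ∑ s : Fˣ, B u * (E s * ψ ((1 + u) * s)) := by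
    rw [← Finset.mul_sum, mul_left_comm, mul_comm (gaussSum E ψ),
      ← gaussSum_mulShift_of_ne_one hE, gaussSum, MulChar.sum_mul_eq_sum_units]
    simp_rw [AddChar.mulShift_apply]
  simp_rw [Finset.mul_sum, h]
  rw [Finset.sum_comm, mul_comm, gaussSum_eq_sum_units (E * B⁻¹) ψ 1, Finset.sum_mul]
  refine Finset.sum_congr rfl fun s _ => ?_
  rw [gaussSum_eq_sum_units B ψ s, Finset.mul_sum]
  refine Finset.sum_congr rfl fun u _ => ?_
  have hB : B s * B⁻¹ s = 1 := by
    rw [← MulChar.mul_apply, mul_inv_cancel, MulChar.one_apply s.isUnit]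
  rw [show (1 + u : F) * s = s + s * u by ring, AddChar.map_add_eq_mul]
  simp only [MulChar.mul_apply, map_mul, Units.val_one, one_mul]
  linear_combination -(B u * E s * ψ s * ψ (s * u)) * hB

/-- The finite field analogue of Barnes' first lemma, nondegenerate case. -/
lemma sum_gaussSum_mul_of_ne_one {A B C : MulChar F ℂ} (h : A * B * C ≠ 1) (ψ : AddChar F ℂ) :
    (∑ χ : MulChar F ℂ, gaussSum (A * χ) ψ * gaussSum (B * χ) ψ * gaussSum (C * χ⁻¹) ψ *
        gaussSum χ⁻¹ ψ) * gaussSum (A * B * C) ψ =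
      ((Fintype.card F : ℂ) - 1) * (gaussSum A ψ * gaussSum B ψ * gaussSum (A * C) ψ *
        gaussSum (B * C) ψ) := by
  classical
  have hB := gaussSum_mul_sum_units_inv_one_add h B ψ
  have hBC := gaussSum_mul_sum_units_inv_one_add h (B * C) ψ
  rw [show A * B * C * B⁻¹ = A * C by rw [mul_right_comm A, mul_inv_cancel_right]] at hB
  rw [mul_assoc A, mul_inv_cancel_right, ← mul_assoc A] at hBC
  have hsplit : ∑ t : Fˣ, ∑ u : Fˣ,
        (B * C) t * B u * gaussSum (A * B * C) (ψ.mulShift ((1 + t) * (1 + u))) =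
      gaussSum (A * B * C) ψ * (∑ t : Fˣ, (B * C) t * (A * B * C)⁻¹ (1 + t)) *
        ∑ u : Fˣ, B u * (A * B * C)⁻¹ (1 + u) := by
    rw [mul_assoc (gaussSum _ _), Finset.sum_mul_sum, Finset.mul_sum]
    refine Finset.sum_congr rfl fun t _ => ?_
    rw [Finset.mul_sum]
    refine Finset.sum_congr rfl fun u _ => ?_
    rw [gaussSum_mulShift_of_ne_one h, map_mul]
    ring
  rw [sum_gaussSum_mul_eq_sum_units, hsplit, hBC]
  linear_combination ((Fintype.card F : ℂ) - 1) * gaussSum (B * C) ψ * gaussSum A ψ * hB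

lemma gaussSum_one_mulShift [DecidableEq F] {ψ : AddChar F ℂ} (hψ : ψ.IsPrimitive) (c : F) :
    gaussSum 1 (ψ.mulShift c) = (if c = 0 then (Fintype.card F : ℂ) else 0) - 1 := by
  split_ifs with hc
  · rw [hc, AddChar.mulShift_zero, gaussSum_one_one, Nat.card_eq_fintype_card,
      Fintype.card_units, Nat.cast_sub Fintype.card_pos, Nat.cast_one]
  · rw [gaussSum_one_left (hψ hc), zero_sub]

/-- The finite field analogue of Barnes' first lemma, degenerate case. -/
lemma sum_gaussSum_mul_of_eq_one {A B C : MulChar F ℂ} (h : A * B * C = 1) {ψ : AddChar F ℂ}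
    (hψ : ψ.IsPrimitive) :
    ∑ χ : MulChar F ℂ, gaussSum (A * χ) ψ * gaussSum (B * χ) ψ * gaussSum (C * χ⁻¹) ψ *
        gaussSum χ⁻¹ ψ =
      ((Fintype.card F : ℂ) - 1) * (-(gaussSum A ψ * gaussSum B ψ * gaussSum (A * C) ψ *
        gaussSum (B * C) ψ) + Fintype.card F * ((Fintype.card F : ℂ) - 1) * (A * B) (-1)) := by
  classical
  have hAC : A * C = B⁻¹ := eq_inv_of_mul_eq_one_left (by rw [mul_right_comm, h])
  obtain ⟨D, hD⟩ : ∃ D, B * C = D := ⟨_, rfl⟩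
  have hA : A = D⁻¹ := eq_inv_of_mul_eq_one_left (by rw [← hD, ← mul_assoc, h])
  have hDg := gaussSum_mul_gaussSum_inv D hψ
  have hBg := gaussSum_mul_gaussSum_inv B hψ
  have hD1 : D⁻¹ (-1) = D (-1) := by rw [MulChar.inv_apply', inv_neg_one]
  have hind (t u : Fˣ) : gaussSum 1 (ψ.mulShift ((1 + t) * (1 + u))) =
      (Fintype.card F : ℂ) * ((if t = -1 then 1 else 0) + (if u = -1 then 1 else 0) -
        (if t = -1 then 1 else 0) * (if u = -1 then 1 else 0)) - 1 := by
    have hneg (a : Fˣ) : (1 + a : F) = 0 ↔ a = -1 := by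
      rw [Units.ext_iff, Units.val_neg, Units.val_one, eq_neg_iff_add_eq_zero, add_comm]
    rw [gaussSum_one_mulShift hψ]
    simp only [mul_eq_zero, hneg]
    by_cases ht : t = -1 <;> by_cases hu : u = -1 <;> simp [ht, hu]
  have hone (χ : MulChar F ℂ) : ∑ t : Fˣ, χ t * (if t = -1 then (1 : ℂ) else 0) = χ (-1) := by
    simp
  have hsum : ∑ t : Fˣ, ∑ u : Fˣ, D t * B u * gaussSum 1 (ψ.mulShift ((1 + t) * (1 + u))) =
      (Fintype.card F : ℂ) * (D (-1) * ∑ u : F, B u + B (-1) * ∑ t : F, D t - D (-1) * B (-1)) -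
        (∑ t : F, D t) * ∑ u : F, B u := by
    rw [MulChar.sum_eq_sum_units, MulChar.sum_eq_sum_units, ← hone D, ← hone B,
      mul_comm (∑ t : Fˣ, B t * _) (∑ t : Fˣ, D t)]
    simp only [Finset.sum_mul_sum]
    simp only [← Finset.sum_add_distrib, ← Finset.sum_sub_distrib, Finset.mul_sum]
    refine Finset.sum_congr rfl fun t _ => Finset.sum_congr rfl fun u _ => ?_
    rw [hind]
    ring
  rw [sum_gaussSum_mul_eq_sum_units, h, hAC, hD, hsum, hA, MulChar.mul_apply, hD1]
  linear_combination ((Fintype.card F : ℂ) - 1) * (gaussSum D ψ * gaussSum D⁻¹ ψ * hBg +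
    (Fintype.card F * B (-1) - ∑ u : F, B u) * hDg)

end CharacterSums

/-- The function `addCharTheta` as an additive character. -/
noncomputable def traceAddChar (p : ℕ) [NeZero p] (F : Type*) [Field F] [Algebra (ZMod p) F]
    {zeta : ℂ} (hzeta : IsPrimitiveRoot zeta p) : AddChar F ℂ :=
  (AddChar.zmodChar p hzeta.pow_eq_one).compAddMonoidHom
    (Algebra.trace (ZMod p) F).toAddMonoidHom

lemma traceAddChar_isPrimitive (p : ℕ) [Fact p.Prime] (F : Type*) [Field F] [Fintype F]
    [Algebra (ZMod p) F] {zeta : ℂ} (hzeta : IsPrimitiveRoot zeta p) :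
    (traceAddChar p F hzeta).IsPrimitive := by
  obtain ⟨a, ha⟩ := Algebra.trace_surjective (ZMod p) F 1
  refine AddChar.IsPrimitive.of_ne_one (AddChar.ne_one_iff.2 ⟨a, ?_⟩)
  have hp : 1 < p := (Fact.out : p.Prime).one_lt
  have : Fact (1 < p) := ⟨hp⟩
  simpa [traceAddChar, AddChar.zmodChar_apply, ha, ZMod.val_one] using hzeta.ne_one hp

lemma gaussS_eq_gaussSum (p : ℕ) [NeZero p] (F : Type*) [Field F] [Fintype F]
    [Algebra (ZMod p) F] {zeta : ℂ} (hzeta : IsPrimitiveRoot zeta p) (χ : MulChar F ℂ) :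
    gaussS p F zeta χ = gaussSum χ (traceAddChar p F hzeta) :=
  rfl

theorem stmt4    (p : ℕ) [Fact p.Prime] (hp : p ≠ 2) (F : Type*) [Field F] [Fintype F]
    [Algebra (ZMod p) F] (zeta : ℂ) (hzeta : IsPrimitiveRoot zeta p)
    (A B C : MulChar F ℂ) :
    mcCarthy2F1 p F zeta A B C 1 =
    gaussS p F zeta (A * C⁻¹) * gaussS p F zeta (B * C⁻¹) / (gaussS p F zeta (C⁻¹) * gaussS p F zeta (A * B * C⁻¹)) +
      (Fintype.card F : ℂ) * ((Fintype.card F : ℂ) - 1) * (A * B) (-1) /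
          (gaussS p F zeta (A) * gaussS p F zeta (B) * gaussS p F zeta (C⁻¹)) *
        (if A * B * C⁻¹ = 1 then 1 else 0) := by
  have hψ := traceAddChar_isPrimitive p F hzeta
  have hq : (Fintype.card F : ℂ) - 1 ≠ 0 :=
    sub_ne_zero.2 (by exact_mod_cast (Fintype.one_lt_card (α := F)).ne')
  have hA := gaussSum_ne_zero A hψ
  have hB := gaussSum_ne_zero B hψ
  have hC := gaussSum_ne_zero C⁻¹ hψ
  have hABC := gaussSum_ne_zero (A * B * C⁻¹) hψ
  simp only [mcCarthy2F1, gaussS_eq_gaussSum p F hzeta, map_one, mul_one, mul_inv]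
  rw [← Finset.sum_div]
  split_ifs with h
  · rw [sum_gaussSum_mul_of_eq_one h hψ, h,
      gaussSum_one_left (by simpa using hψ one_ne_zero)]
    field_simp
  · have hsum := sum_gaussSum_mul_of_ne_one h (traceAddChar p F hzeta)
    rw [eq_div_of_mul_eq hABC hsum]
    field_simp
    ring
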